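/- With the Q-polynomial distance-regular graph setup and the split subspaces Ṽ^{μν}_{i,j}, for 0 ≤ i,j,r,s ≤ D the subspaces Ṽ^{↓↓}_{i,j} and Ṽ^{↑↑}_{r,s} are orthogonal with respect to the standard Hermitian form unless i + r = D and j + s = D. -/

import Mathlib

noncomputable section

open Matrix Finset
open scoped ComplexInnerProductSpace

/-- A `Q`-polynomial distance-regular graph setup: a finite connected simple graph `G` on `X`
with diameter `D ≥ 3`, intersection numbers `p h i j`, primitive idempotents
`E 0, …, E D` of the Bose–Mesner algebra with (distinct, real) eigenvalues `θ 0, …, θ D`,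
and Krein parameters `q h i j` satisfying the `Q`-polynomial condition with respect to the
ordering `E 0, …, E D`. -/
structure QPolyDRG (X : Type*) [Fintype X] [DecidableEq X] where
  G : SimpleGraph X
  conn : G.Connected
  D : ℕ
  hD3 : 3 ≤ D
  dist_le : ∀ y z : X, G.dist y z ≤ D
  dist_eq : ∃ y z : X, G.dist y z = D
  p : ℕ → ℕ → ℕ → ℕ
  hp : ∀ h i j : ℕ, h ≤ D → i ≤ D → j ≤ D → ∀ y z : X, G.dist y z = h →
    Nat.card {w : X // G.dist y w = i ∧ G.dist w z = j} = p h i j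
  E : ℕ → Matrix X X ℂ
  θ : ℕ → ℝ
  q : ℕ → ℕ → ℕ → ℝ
  hE0 : E 0 = ((Fintype.card X : ℂ))⁻¹ • Matrix.of (fun _ _ => (1 : ℂ))
  hEsum : ∑ i ∈ Finset.range (D + 1), E i = 1
  hEmul : ∀ i ≤ D, ∀ j ≤ D, E i * E j = if i = j then E i else 0
  hEsym : ∀ i ≤ D, (E i)ᵀ = E i
  hEreal : ∀ i ≤ D, ∀ y z : X, ((E i) y z).im = 0
  hEinM : ∀ i ≤ D, E i ∈ Submodule.span ℂ
    {B : Matrix X X ℂ | ∃ k ≤ D, B = Matrix.of (fun y z => if G.dist y z = k then (1 : ℂ) else 0)}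
  hAE : ∀ i ≤ D,
    Matrix.of (fun y z => if G.dist y z = 1 then (1 : ℂ) else 0) * E i = (θ i : ℂ) • E i
  θ_inj : ∀ i ≤ D, ∀ j ≤ D, θ i = θ j → i = j
  hKrein : ∀ i ≤ D, ∀ j ≤ D, Matrix.hadamard (E i) (E j) =
    ((Fintype.card X : ℂ))⁻¹ • ∑ h ∈ Finset.range (D + 1), (q h i j : ℂ) • E h
  hq_zero : ∀ h ≤ D, ∀ i ≤ D, ∀ j ≤ D, (i + j < h ∨ h + j < i ∨ h + i < j) → q h i j = 0
  hq_ne : ∀ h ≤ D, ∀ i ≤ D, ∀ j ≤ D, (h = i + j ∨ i = h + j ∨ j = h + i) → q h i j ≠ 0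

namespace QPolyDRG

variable {X : Type*} [Fintype X] [DecidableEq X] (S : QPolyDRG X) (x : X)

/-- The `i`-th distance matrix `A_i`. -/
def Amat (i : ℕ) : Matrix X X ℂ :=
  Matrix.of (fun y z => if S.G.dist y z = i then (1 : ℂ) else 0)

/-- The adjacency matrix `A = A_1`. -/
def adj : Matrix X X ℂ := S.Amat 1

/-- The `i`-th dual idempotent `E*_i = E*_i(x)` with respect to the base vertex `x`. -/
def Estar (i : ℕ) : Matrix X X ℂ :=
  Matrix.diagonal (fun y => if S.G.dist x y = i then (1 : ℂ) else 0)

/-- The dual adjacency matrix `A* = A*(x)`, with `(A*)_{yy} = |X| (E_1)_{xy}`. -/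
def Astar : Matrix X X ℂ :=
  Matrix.diagonal (fun y => (Fintype.card X : ℂ) * S.E 1 x y)

/-- The subspace `E_i V` of the standard module, with the convention that it is `0`
for `i ∉ {0, …, D}`. -/
def EV (i : ℤ) : Submodule ℂ (EuclideanSpace ℂ X) :=
  if 0 ≤ i ∧ i ≤ S.D then LinearMap.range (Matrix.toEuclideanLin (S.E i.toNat)) else ⊥

/-- The `i`-th subconstituent `E*_i V` with respect to `x`, with the convention that it is `0`
for `i ∉ {0, …, D}`. -/
def EstarV (i : ℤ) : Submodule ℂ (EuclideanSpace ℂ X) :=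
  if 0 ≤ i ∧ i ≤ S.D then LinearMap.range (Matrix.toEuclideanLin (S.Estar x i.toNat)) else ⊥

/-- The subconstituent (Terwilliger) algebra `T = T(x)`, generated by `A` and `A*`. -/
def Talg : Subalgebra ℂ (Matrix X X ℂ) := Algebra.adjoin ℂ {S.adj, S.Astar x}

/-- A `T`-module: a subspace `W ⊆ V` with `B W ⊆ W` for all `B ∈ T`. -/
def IsTModule (W : Submodule ℂ (EuclideanSpace ℂ X)) : Prop :=
  ∀ B ∈ S.Talg x, ∀ w ∈ W, Matrix.toEuclideanLin B w ∈ W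

/-- An irreducible `T`-module. -/
def IsIrredTModule (W : Submodule ℂ (EuclideanSpace ℂ X)) : Prop :=
  S.IsTModule x W ∧ W ≠ ⊥ ∧ ∀ W' ≤ W, S.IsTModule x W' → W' = ⊥ ∨ W' = W

/-- The subspace `E_i W`, with the convention that it is `0` for `i ∉ {0, …, D}`. -/
def EW (W : Submodule ℂ (EuclideanSpace ℂ X)) (i : ℤ) : Submodule ℂ (EuclideanSpace ℂ X) :=
  if 0 ≤ i ∧ i ≤ S.D then Submodule.map (Matrix.toEuclideanLin (S.E i.toNat)) W else ⊥

/-- The subspace `E*_i W`, with the convention that it is `0` for `i ∉ {0, …, D}`. -/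
def EstarW (W : Submodule ℂ (EuclideanSpace ℂ X)) (i : ℤ) : Submodule ℂ (EuclideanSpace ℂ X) :=
  if 0 ≤ i ∧ i ≤ S.D then Submodule.map (Matrix.toEuclideanLin (S.Estar x i.toNat)) W else ⊥


/-- The endpoint `ρ = min { i : E*_i W ≠ 0 }` of a `T`-module `W`. -/
def endpt (W : Submodule ℂ (EuclideanSpace ℂ X)) : ℕ :=
  sInf {i : ℕ | i ≤ S.D ∧ S.EstarW x W i ≠ ⊥}

/-- The dual endpoint `τ = min { i : E_i W ≠ 0 }` of a `T`-module `W`. -/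
def dualEndpt (W : Submodule ℂ (EuclideanSpace ℂ X)) : ℕ :=
  sInf {i : ℕ | i ≤ S.D ∧ S.EW W i ≠ ⊥}

/-- The diameter `d = |{ i : E*_i W ≠ 0 }| - 1` of a `T`-module `W`. -/
def diam (W : Submodule ℂ (EuclideanSpace ℂ X)) : ℕ :=
  Set.ncard {i : ℕ | i ≤ S.D ∧ S.EstarW x W i ≠ ⊥} - 1

/-- The dual diameter `|{ i : E_i W ≠ 0 }| - 1` of a `T`-module `W`. -/
def dualDiam (W : Submodule ℂ (EuclideanSpace ℂ X)) : ℕ :=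
  Set.ncard {i : ℕ | i ≤ S.D ∧ S.EW W i ≠ ⊥} - 1

/-- The split subspace `W^{μν}_h` of an irreducible `T`-module `W` with endpoint `ρ`,
dual endpoint `τ` and diameter `d`.  Here `μ = false` stands for `↓` and `μ = true`
for `↑`, and similarly for `ν`; e.g.
`W^{↓↓}_h = (E*_ρ W + ⋯ + E*_{ρ+h} W) ∩ (E_τ W + ⋯ + E_{τ+d-h} W)`. -/
def Wsplit (W : Submodule ℂ (EuclideanSpace ℂ X)) (ρ τ d : ℕ) (μ ν : Bool) (h : ℕ) :
    Submodule ℂ (EuclideanSpace ℂ X) :=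
  (if μ then ⨆ k ∈ Finset.Icc (ρ + d - h) (ρ + d), S.EstarW x W k
    else ⨆ k ∈ Finset.Icc ρ (ρ + h), S.EstarW x W k) ⊓
  (if ν then ⨆ k ∈ Finset.Icc (τ + h) (τ + d), S.EW W k
    else ⨆ k ∈ Finset.Icc τ (τ + d - h), S.EW W k)

/-- The subspace `V^{μν}_{i,j}` (interpreted as `0` if `i = -1` or `j = -1`).
Here `μ = false` stands for `↓` and `μ = true` for `↑`, and similarly for `ν`; e.g.
`V^{↓↓}_{i,j} = (E*_0 V + ⋯ + E*_i V) ∩ (E_0 V + ⋯ + E_j V)` and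
`V^{↑↑}_{i,j} = (E*_D V + ⋯ + E*_{D-i} V) ∩ (E_D V + ⋯ + E_{D-j} V)`. -/
def Vsplit (μ ν : Bool) (i j : ℤ) : Submodule ℂ (EuclideanSpace ℂ X) :=
  if 0 ≤ i ∧ 0 ≤ j then
    (if μ then ⨆ k ∈ Finset.Icc (S.D - i.toNat) S.D, S.EstarV x k
      else ⨆ k ∈ Finset.range (i.toNat + 1), S.EstarV x k) ⊓
    (if ν then ⨆ k ∈ Finset.Icc (S.D - j.toNat) S.D, S.EV k
      else ⨆ k ∈ Finset.range (j.toNat + 1), S.EV k)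
  else ⊥

/-- The subspace `Ṽ^{μν}_{i,j}`: the orthogonal complement of
`V^{μν}_{i-1,j} + V^{μν}_{i,j-1}` in `V^{μν}_{i,j}` with respect to the standard
Hermitian form. -/
def tildeV (μ ν : Bool) (i j : ℕ) : Submodule ℂ (EuclideanSpace ℂ X) :=
  S.Vsplit x μ ν i j ⊓ (S.Vsplit x μ ν ((i : ℤ) - 1) j ⊔ S.Vsplit x μ ν i ((j : ℤ) - 1))ᗮ

end QPolyDRG

/-- Abstract tridiagonal system. -/
structure TDSys (V : Type*) [NormedAddCommGroup V] [InnerProductSpace ℂ V] where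
  D : ℕ
  A : V →ₗ[ℂ] V
  B : V →ₗ[ℂ] V
  P : ℕ → V →ₗ[ℂ] V
  Q : ℕ → V →ₗ[ℂ] V
  a : ℕ → ℂ
  b : ℕ → ℂ
  Asym : A.IsSymmetric
  Bsym : B.IsSymmetric
  Psym : ∀ k ≤ D, (P k).IsSymmetric
  Qsym : ∀ k ≤ D, (Q k).IsSymmetric
  Psum : ∀ v, ∑ k ∈ Finset.range (D + 1), P k v = v
  Qsum : ∀ v, ∑ k ∈ Finset.range (D + 1), Q k v = v
  Porth : ∀ k ≤ D, ∀ l ≤ D, k ≠ l → ∀ v, P k (P l v) = 0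
  Qorth : ∀ k ≤ D, ∀ l ≤ D, k ≠ l → ∀ v, Q k (Q l v) = 0
  PA : ∀ k ≤ D, ∀ v, P k (A v) = a k • P k v
  QB : ∀ k ≤ D, ∀ v, Q k (B v) = b k • Q k v
  ainj : ∀ k ≤ D, ∀ l ≤ D, a k = a l → k = l ∨ P l = 0 ∨ P k = 0
  binj : ∀ k ≤ D, ∀ l ≤ D, b k = b l → k = l ∨ Q l = 0 ∨ Q k = 0
  QAQ : ∀ k ≤ D, ∀ l ≤ D, (k + 1 < l ∨ l + 1 < k) → ∀ v, Q k (A (Q l v)) = 0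
  PBP : ∀ k ≤ D, ∀ l ≤ D, (k + 1 < l ∨ l + 1 < k) → ∀ v, P k (B (P l v)) = 0

namespace TDSys

variable {V : Type*} [NormedAddCommGroup V] [InnerProductSpace ℂ V] (T : TDSys V)

def swap : TDSys V where
  D := T.D
  A := T.B
  B := T.A
  P := T.Q
  Q := T.P
  a := T.b
  b := T.a
  Asym := T.Bsym
  Bsym := T.Asym
  Psym := T.Qsym
  Qsym := T.Psym
  Psum := T.Qsum
  Qsum := T.Psum
  Porth := T.Qorth
  Qorth := T.Porth
  PA := T.QB
  QB := T.PA
  ainj := T.binj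
  binj := T.ainj
  QAQ := T.PBP
  PBP := T.QAQ

def rev : TDSys V where
  D := T.D
  A := T.A
  B := T.B
  P := fun k => T.P (T.D - k)
  Q := fun k => T.Q (T.D - k)
  a := fun k => T.a (T.D - k)
  b := fun k => T.b (T.D - k)
  Asym := T.Asym
  Bsym := T.Bsym
  Psym := fun k _ => T.Psym _ (by omega)
  Qsym := fun k _ => T.Qsym _ (by omega)
  Psum := fun v => by
    have := Finset.sum_range_reflect (fun k => T.P k v) (T.D + 1)
    simp only [Nat.add_sub_cancel] at this
    rw [this, T.Psum]
  Qsum := fun v => by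
    have := Finset.sum_range_reflect (fun k => T.Q k v) (T.D + 1)
    simp only [Nat.add_sub_cancel] at this
    rw [this, T.Qsum]
  Porth := fun k _ l _ _ => T.Porth _ (by omega) _ (by omega) (by omega)
  Qorth := fun k _ l _ _ => T.Qorth _ (by omega) _ (by omega) (by omega)
  PA := fun k _ => T.PA _ (by omega)
  QB := fun k _ => T.QB _ (by omega)
  ainj := fun k _ l _ h => by
    rcases T.ainj _ (by omega) _ (by omega) h with h | h
    · left; omega
    · exact Or.inr h
  binj := fun k _ l _ h => by
    rcases T.binj _ (by omega) _ (by omega) h with h | h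
    · left; omega
    · exact Or.inr h
  QAQ := fun k _ l _ _ => T.QAQ _ (by omega) _ (by omega) (by omega)
  PBP := fun k _ l _ _ => T.PBP _ (by omega) _ (by omega) (by omega)

/-- Vectors supported on `Q k`, `k < i`. -/
def F (i : ℕ) : Submodule ℂ V where
  carrier := {v | ∀ k ≤ T.D, i ≤ k → T.Q k v = 0}
  add_mem' := fun {u v} hu hv k h1 h2 => by rw [map_add, hu k h1 h2, hv k h1 h2, add_zero]
  zero_mem' := fun k _ _ => map_zero _
  smul_mem' := fun c v hv k h1 h2 => by rw [map_smul, hv k h1 h2, smul_zero]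

def G (i : ℕ) : Submodule ℂ V := T.swap.F i

theorem mem_F {i : ℕ} {v : V} : v ∈ T.F i ↔ ∀ k ≤ T.D, i ≤ k → T.Q k v = 0 := Iff.rfl
theorem mem_G {i : ℕ} {v : V} : v ∈ T.G i ↔ ∀ k ≤ T.D, i ≤ k → T.P k v = 0 := Iff.rfl

theorem F_mono {i j : ℕ} (h : i ≤ j) : T.F i ≤ T.F j := fun _ hv k h1 h2 => hv k h1 (h.trans h2)
theorem G_mono {i j : ℕ} (h : i ≤ j) : T.G i ≤ T.G j := T.swap.F_mono h

theorem F_zero {v : V} (hv : v ∈ T.F 0) : v = 0 := by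
  rw [← T.Qsum v]
  exact Finset.sum_eq_zero fun k hk => hv k (by simp at hk; omega) (Nat.zero_le _)
theorem G_zero {v : V} (hv : v ∈ T.G 0) : v = 0 := T.swap.F_zero hv

theorem PP {k : ℕ} (hk : k ≤ T.D) (v : V) : T.P k (T.P k v) = T.P k v := by
  conv_rhs => rw [← T.Psum v]
  rw [map_sum, Finset.sum_eq_single k]
  · intro l hl hlk
    exact T.Porth k hk l (by simp at hl; omega) (Ne.symm hlk) v
  · intro h; simp at h; omega
theorem QQ {k : ℕ} (hk : k ≤ T.D) (v : V) : T.Q k (T.Q k v) = T.Q k v := T.swap.PP hk v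

theorem A_F {i : ℕ} {v : V} (hv : v ∈ T.F i) : T.A v ∈ T.F (i + 1) := by
  intro k hk hik
  rw [← T.Qsum v, map_sum, map_sum]
  refine Finset.sum_eq_zero fun l hl => ?_
  have hl' : l ≤ T.D := by simp at hl; omega
  by_cases h : i ≤ l
  · rw [hv l hl' h, map_zero, map_zero]
  · exact T.QAQ k hk l hl' (by omega) v

def W (n : ℕ) : Submodule ℂ V := ⨆ i : ℕ, ⨆ j : ℕ, ⨆ _ : i + j = n, T.F i ⊓ T.G j

theorem le_W {i j n : ℕ} (h : i + j = n) : T.F i ⊓ T.G j ≤ T.W n :=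
  le_iSup_of_le i (le_iSup_of_le j (le_iSup_of_le h le_rfl))

theorem W_le {n : ℕ} {M : Submodule ℂ V} (h : ∀ i j, i + j = n → T.F i ⊓ T.G j ≤ M) :
    T.W n ≤ M := iSup_le fun i => iSup_le fun j => iSup_le fun e => h i j e

theorem W_swap (n : ℕ) : T.swap.W n = T.W n := by
  apply le_antisymm
  · refine T.swap.W_le fun i j e => ?_
    refine le_trans ?_ (T.le_W (i := j) (j := i) (by omega))
    exact fun v hv => ⟨hv.2, hv.1⟩
  · refine T.W_le fun i j e => ?_
    refine le_trans ?_ (T.swap.le_W (i := j) (j := i) (by omega))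
    exact fun v hv => ⟨hv.2, hv.1⟩

theorem W_mono {n m : ℕ} (h : n ≤ m) : T.W n ≤ T.W m :=
  T.W_le fun i j e => le_trans (inf_le_inf_right _ (T.F_mono (show i ≤ i + (m - n) by omega)))
    (T.le_W (by omega))

theorem A_W (n : ℕ) : ∀ v ∈ T.W n, T.A v ∈ T.W n := by
  suffices T.W n ≤ (T.W n).comap T.A from this
  refine T.W_le fun i j e v hv => ?_
  rw [Submodule.mem_comap]
  obtain _ | j := j
  · rw [T.G_zero hv.2, map_zero]; exact zero_mem _
  have h1 : T.A v - T.a j • v ∈ T.W n := by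
    refine T.le_W (i := i + 1) (j := j) (by omega) ⟨?_, ?_⟩
    · exact sub_mem (T.A_F hv.1) (Submodule.smul_mem _ _ (T.F_mono (Nat.le_succ i) hv.1))
    · rw [SetLike.mem_coe, mem_G]
      intro k hk hjk
      rw [map_sub, map_smul, T.PA k hk]
      rcases hjk.eq_or_lt with rfl | h
      · simp
      · rw [(T.mem_G.1 hv.2) k hk h]; simp
  have h2 : v ∈ T.W n := T.le_W e hv
  have := add_mem h1 (Submodule.smul_mem _ (T.a j) h2)
  simpa using this

theorem B_W (n : ℕ) : ∀ v ∈ T.W n, T.B v ∈ T.W n := by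
  have := T.swap.A_W n
  rw [W_swap] at this
  exact this

/-- A subspace invariant under `A` is invariant under the idempotents `P k`. -/
theorem P_inv {N : Submodule ℂ V} (hN : ∀ v ∈ N, T.A v ∈ N) {i : ℕ} (hi : i ≤ T.D) :
    ∀ v ∈ N, T.P i v ∈ N := by
  classical
  intro v hv
  by_cases h0 : T.P i = 0
  · rw [h0]; exact zero_mem _
  have key : ∀ s : Finset ℕ, (∀ k ∈ s, k ≤ T.D ∧ k ≠ i ∧ T.P k ≠ 0) →
      ∃ w ∈ N, ∃ c : ℂ, c ≠ 0 ∧ T.P i w = c • T.P i v ∧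
        (∀ k ∈ s, T.P k w = 0) ∧ ∀ k ≤ T.D, T.P k v = 0 → T.P k w = 0 := by
    intro s
    induction s using Finset.induction_on with
    | empty => exact fun _ => ⟨v, hv, 1, one_ne_zero, by simp, by simp, fun _ _ h => h⟩
    | insert l s hl ih =>
      intro hs
      obtain ⟨w, hw, c, hc, h1, h2, h3⟩ := ih fun k hk => hs k (Finset.mem_insert_of_mem hk)
      obtain ⟨hl1, hl2, hl3⟩ := hs l (Finset.mem_insert_self _ _)
      refine ⟨T.A w - T.a l • w, sub_mem (hN w hw) (Submodule.smul_mem _ _ hw),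
        (T.a i - T.a l) * c, mul_ne_zero ?_ hc, ?_, ?_, ?_⟩
      · intro h
        rcases T.ainj i hi l hl1 (sub_eq_zero.1 h) with h | h | h
        · exact hl2 h.symm
        · exact hl3 h
        · exact h0 h
      · rw [map_sub, map_smul, T.PA i hi, h1, ← sub_smul, smul_smul]
      · intro k hk
        rw [map_sub, map_smul]
        rcases Finset.mem_insert.1 hk with rfl | hk'
        · rw [T.PA _ hl1, sub_self]
        · rw [T.PA _ (hs k hk).1, h2 k hk']; simp
      · intro k hk hkv
        rw [map_sub, map_smul, T.PA _ hk, h3 k hk hkv]; simp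
  obtain ⟨w, hw, c, hc, h1, h2, h3⟩ := key
    ((Finset.range (T.D + 1)).filter fun k => k ≠ i ∧ T.P k ≠ 0) (by
      intro k hk
      simp only [Finset.mem_filter, Finset.mem_range] at hk
      exact ⟨by omega, hk.2⟩)
  have hwe : w = c • T.P i v := by
    rw [← h1]
    conv_lhs => rw [← T.Psum w]
    refine Finset.sum_eq_single i ?_ ?_
    · intro k hk hki
      by_cases hk0 : T.P k = 0
      · rw [hk0]; rfl
      · exact h2 k (Finset.mem_filter.2 ⟨hk, hki, hk0⟩)
    · intro h; simp at h; omega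
  have : T.P i v = c⁻¹ • w := by rw [hwe, smul_smul, inv_mul_cancel₀ hc, one_smul]
  rw [this]
  exact Submodule.smul_mem _ _ hw

theorem Q_inv {N : Submodule ℂ V} (hN : ∀ v ∈ N, T.B v ∈ N) {i : ℕ} (hi : i ≤ T.D) :
    ∀ v ∈ N, T.Q i v ∈ N := T.swap.P_inv hN hi

theorem perp_inv {N : Submodule ℂ V} {C : V →ₗ[ℂ] V} (hC : C.IsSymmetric)
    (hN : ∀ v ∈ N, C v ∈ N) : ∀ v ∈ Nᗮ, C v ∈ Nᗮ := by
  intro v hv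
  rw [Submodule.mem_orthogonal] at hv ⊢
  intro u hu
  rw [← hC u v]
  exact hv _ (hN u hu)

/-- orthogonality of `F a` and the reversed `F b`. -/
theorem F_orth {i r : ℕ} (h : i + r ≤ T.D + 1) {u v : V} (hu : u ∈ T.F i) (hv : v ∈ T.rev.F r) :
    inner ℂ u v = 0 := by
  rw [← T.Qsum u, sum_inner]
  refine Finset.sum_eq_zero fun k hk => ?_
  have hk' : k ≤ T.D := by simp at hk; omega
  by_cases hik : i ≤ k
  · rw [hu k hk' hik, inner_zero_left]
  · rw [T.Qsym k hk' u v]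
    have := hv (T.D - k) (Nat.sub_le _ _) (by omega)
    have e : T.rev.Q (T.D - k) = T.Q k := by
      show T.Q (T.D - (T.D - k)) = T.Q k
      congr 1; omega
    rw [← e, this, inner_zero_right]

theorem G_orth {i r : ℕ} (h : i + r ≤ T.D + 1) {u v : V} (hu : u ∈ T.G i) (hv : v ∈ T.rev.G r) :
    inner ℂ u v = 0 := T.swap.F_orth h hu hv

theorem W_orth {n m : ℕ} (h : n + m ≤ 2 * T.D + 3) {u v : V} (hu : u ∈ T.W n)
    (hv : v ∈ T.rev.W m) : inner ℂ u v = 0 := by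
  have : T.W n ≤ (T.rev.W m)ᗮ := by
    refine T.W_le fun i j e u hu => ?_
    rw [Submodule.mem_orthogonal']
    intro v hv
    have : T.rev.W m ≤ (Submodule.span ℂ {u})ᗮ := by
      refine T.rev.W_le fun r s e' v hv => ?_
      rw [Submodule.mem_orthogonal_singleton_iff_inner_right]
      by_cases h' : i + r ≤ T.D + 1
      · exact T.F_orth h' hu.1 hv.1
      · exact T.G_orth (by omega) hu.2 hv.2
    exact Submodule.mem_orthogonal_singleton_iff_inner_right.1 (this hv)
  exact (Submodule.mem_orthogonal' _ _).1 (this hu) v hv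

theorem W_sup [FiniteDimensional ℂ V] {n m : ℕ} (h : 2 * T.D + 3 ≤ n + m) :
    T.W n ⊔ T.rev.W m = ⊤ := by
  classical
  set M := T.W n ⊔ T.rev.W m with hM
  have hAM : ∀ v ∈ M, T.A v ∈ M := by
    suffices M ≤ M.comap T.A from this
    exact sup_le (fun v hv => (le_sup_left : T.W n ≤ M) (T.A_W n v hv))
      (fun v hv => (le_sup_right : T.rev.W m ≤ M) (T.rev.A_W m v hv))
  have hBM : ∀ v ∈ M, T.B v ∈ M := by
    suffices M ≤ M.comap T.B from this
    exact sup_le (fun v hv => (le_sup_left : T.W n ≤ M) (T.B_W n v hv))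
      (fun v hv => (le_sup_right : T.rev.W m ≤ M) (T.rev.B_W m v hv))
  have hA := perp_inv T.Asym hAM
  have hB := perp_inv T.Bsym hBM
  by_contra hne
  have hbot : Mᗮ ≠ ⊥ := fun h => hne ((Submodule.orthogonal_eq_bot_iff).1 h)
  obtain ⟨v, hv, hv0⟩ := Submodule.exists_mem_ne_zero_of_ne_bot hbot
  have hdis : ∀ w ∈ Mᗮ, w ∈ M → w = 0 := fun w h1 h2 => by
    have := (Submodule.mem_orthogonal _ _).1 h1 w h2
    exact inner_self_eq_zero.1 this
  -- e maximal
  let sQ := (Finset.range (T.D + 1)).filter fun k => ∃ w ∈ Mᗮ, T.Q k w ≠ 0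
  let sP := (Finset.range (T.D + 1)).filter fun k => ∃ w ∈ Mᗮ, T.P k w ≠ 0
  have hsQ : sQ.Nonempty := by
    by_contra hs
    apply hv0
    rw [← T.Qsum v]
    refine Finset.sum_eq_zero fun k hk => ?_
    by_contra hk0
    exact hs ⟨k, Finset.mem_filter.2 ⟨hk, v, hv, hk0⟩⟩
  have hsP : sP.Nonempty := by
    by_contra hs
    apply hv0
    rw [← T.Psum v]
    refine Finset.sum_eq_zero fun k hk => ?_
    by_contra hk0
    exact hs ⟨k, Finset.mem_filter.2 ⟨hk, v, hv, hk0⟩⟩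
  obtain ⟨e, he, hemax⟩ := sQ.exists_max_image id hsQ
  obtain ⟨t, ht, htmin⟩ := sP.exists_min_image id hsP
  obtain ⟨he1, w, hw, hw0⟩ := Finset.mem_filter.1 he
  obtain ⟨ht1, z, hz, hz0⟩ := Finset.mem_filter.1 ht
  have he2 : e ≤ T.D := by simp at he1; omega
  have ht2 : t ≤ T.D := by simp at ht1; omega
  have hQv : ∀ y ∈ Mᗮ, ∀ k ≤ T.D, e < k → T.Q k y = 0 := by
    intro y hy k hk hek
    by_contra h0
    have := hemax k (Finset.mem_filter.2 ⟨by simp; omega, y, hy, h0⟩)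
    simp at this; omega
  have hPv : ∀ y ∈ Mᗮ, ∀ k ≤ T.D, k < t → T.P k y = 0 := by
    intro y hy k hk hek
    by_contra h0
    have := htmin k (Finset.mem_filter.2 ⟨by simp; omega, y, hy, h0⟩)
    simp at this; omega
  have hz1 : T.P t z ∈ Mᗮ := T.P_inv hA ht2 z hz
  have hw1 : T.Q e w ∈ Mᗮ := T.Q_inv hB he2 w hw
  have hzW : T.P t z ∈ T.W (e + 1 + (t + 1)) := by
    refine T.le_W rfl ⟨?_, ?_⟩
    · exact fun k hk hk' => hQv _ hz1 k hk hk'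
    · rw [SetLike.mem_coe, mem_G]
      exact fun k hk hk' => T.Porth k hk t ht2 (by omega) z
  have hwW : T.Q e w ∈ T.rev.W (T.D - e + 1 + (T.D - t + 1)) := by
    refine T.rev.le_W rfl ⟨?_, ?_⟩
    · rw [SetLike.mem_coe, mem_F]
      intro k hk hk'
      have hk : k ≤ T.D := hk
      exact T.Qorth (T.D - k) (by omega) e he2 (by omega) w
    · rw [SetLike.mem_coe, mem_G]
      intro k hk hk'
      have hk : k ≤ T.D := hk
      exact hPv _ hw1 (T.D - k) (by omega) (by omega)
  by_cases hc : e + 1 + (t + 1) ≤ n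
  · exact hz0 (hdis _ hz1 ((le_sup_left : T.W n ≤ M) (T.W_mono hc hzW)))
  · exact hw0 (hdis _ hw1 ((le_sup_right : T.rev.W m ≤ M)
      (T.rev.W_mono (by omega) hwW)))

/-- the split `tilde` space lies in the orthogonal complement of `W (i+j+1)` -/
theorem tilde_perp [FiniteDimensional ℂ V] {i j : ℕ} {u : V} (hu : u ∈ T.F (i + 1) ⊓ T.G (j + 1))
    (h1 : ∀ w ∈ T.F i ⊓ T.G (j + 1), inner ℂ u w = 0)
    (h2 : ∀ w ∈ T.F (i + 1) ⊓ T.G j, inner ℂ u w = 0) : u ∈ (T.W (i + j + 1))ᗮ := by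
  obtain ⟨p, hp, z, hz, rfl⟩ := (T.W (i + j + 1)).exists_add_mem_mem_orthogonal u
  -- p lies in F (i+1) ⊓ G (j+1)
  have hpF : p ∈ T.F (i + 1) := by
    intro k hk hik
    have := hu.1 k hk hik
    rw [map_add] at this
    have hq1 := T.Q_inv (T.B_W _) hk p hp
    have hq2 := T.Q_inv (perp_inv T.Bsym (T.B_W _)) hk z hz
    have e : T.Q k p = - T.Q k z := eq_neg_of_add_eq_zero_left this
    have := (Submodule.mem_orthogonal _ _).1 (neg_mem hq2) _ hq1
    rw [← e] at this
    exact inner_self_eq_zero.1 this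
  have hpG : p ∈ T.G (j + 1) := by
    intro k hk hik
    have := hu.2 k hk hik
    rw [map_add] at this
    have hq1 := T.P_inv (T.A_W _) hk p hp
    have hq2 := T.P_inv (perp_inv T.Asym (T.A_W _)) hk z hz
    have e : T.P k p = - T.P k z := eq_neg_of_add_eq_zero_left this
    have := (Submodule.mem_orthogonal _ _).1 (neg_mem hq2) _ hq1
    rw [← e] at this
    exact inner_self_eq_zero.1 this
  have hWs : T.W (i + j + 1) ≤ T.F i ⊔ T.G j := by
    refine T.W_le fun k l e => ?_
    by_cases h : k ≤ i
    · exact le_trans (inf_le_left.trans (T.F_mono h)) le_sup_left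
    · exact le_trans (inf_le_right.trans (T.G_mono (by omega))) le_sup_right
  obtain ⟨c, hc, d, hd, hcd⟩ := Submodule.mem_sup.1 (hWs hp)
  have hc' : c ∈ T.G (j + 1) := by
    have : c = p - d := by rw [← hcd]; abel
    rw [this]; exact sub_mem hpG (T.G_mono (Nat.le_succ j) hd)
  have hd' : d ∈ T.F (i + 1) := by
    have : d = p - c := by rw [← hcd]; abel
    rw [this]; exact sub_mem hpF (T.F_mono (Nat.le_succ i) hc)
  have hup : inner ℂ (p + z) p = 0 := by
    conv_lhs => rw [← hcd]
    rw [inner_add_right]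
    rw [hcd, h1 c ⟨hc, hc'⟩, h2 d ⟨hd', hd⟩, add_zero]
  rw [inner_add_left, (Submodule.mem_orthogonal' _ _).1 hz p hp, add_zero] at hup
  rw [inner_self_eq_zero.1 hup, zero_add]
  exact hz

theorem main [FiniteDimensional ℂ V] {i j r s : ℕ} (hi : i ≤ T.D) (hj : j ≤ T.D)
    (hne : ¬ (i + r = T.D ∧ j + s = T.D)) {u v : V}
    (hu : u ∈ T.F (i + 1) ⊓ T.G (j + 1))
    (h1 : ∀ w ∈ T.F i ⊓ T.G (j + 1), inner ℂ u w = 0)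
    (h2 : ∀ w ∈ T.F (i + 1) ⊓ T.G j, inner ℂ u w = 0)
    (hv : v ∈ T.rev.F (r + 1) ⊓ T.rev.G (s + 1))
    (h3 : ∀ w ∈ T.rev.F r ⊓ T.rev.G (s + 1), inner ℂ v w = 0)
    (h4 : ∀ w ∈ T.rev.F (r + 1) ⊓ T.rev.G s, inner ℂ v w = 0) : inner ℂ u v = 0 := by
  by_cases c1 : i + r < T.D
  · exact T.F_orth (by omega) hu.1 hv.1
  by_cases c2 : j + s < T.D
  · exact T.G_orth (by omega) hu.2 hv.2
  have hu' := T.tilde_perp hu h1 h2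
  have hv' := T.rev.tilde_perp hv h3 h4
  have htop := T.W_sup (n := i + j + 1) (m := 2 * T.D + 2 - (i + j)) (by omega)
  have hmem : u ∈ T.W (i + j + 1) ⊔ T.rev.W (2 * T.D + 2 - (i + j)) := htop ▸ Submodule.mem_top
  obtain ⟨c, hc, d, hd, rfl⟩ := Submodule.mem_sup.1 hmem
  have hcz : c = 0 := by
    have := (Submodule.mem_orthogonal _ _).1 hu' c hc
    rw [inner_add_right, T.W_orth (by omega) hc hd, add_zero] at this
    exact inner_self_eq_zero.1 this
  rw [hcz, zero_add]
  exact (Submodule.mem_orthogonal _ _).1 hv' d (T.rev.W_mono (by omega) hd)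

theorem iSup_range (s : Finset ℕ) (hs : ∀ k ∈ s, k ≤ T.D) (v : V) :
    v ∈ (⨆ k ∈ s, LinearMap.range (T.P k)) ↔ ∀ k ≤ T.D, k ∉ s → T.P k v = 0 := by
  classical
  constructor
  · intro hv k hk hks
    have : (⨆ k ∈ s, LinearMap.range (T.P k)) ≤ LinearMap.ker (T.P k) := by
      refine iSup₂_le fun l hl => ?_
      rintro _ ⟨w, rfl⟩
      exact T.Porth k hk l (hs l hl) (by rintro rfl; exact hks hl) w
    exact this hv
  · intro h
    rw [← T.Psum v]
    refine sum_mem fun k hk => ?_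
    by_cases hks : k ∈ s
    · exact Submodule.mem_iSup_of_mem k (Submodule.mem_iSup_of_mem hks ⟨v, rfl⟩)
    · rw [h k (by simp at hk; omega) hks]; exact zero_mem _

end TDSys

namespace QPolyDRG

variable {X : Type*} [Fintype X] [DecidableEq X] (S : QPolyDRG X) (x : X)

theorem E_herm {i : ℕ} (hi : i ≤ S.D) : (S.E i).IsHermitian := by
  ext y z
  rw [Matrix.conjTranspose_apply]
  have h1 : S.E i z y = S.E i y z := congrFun (congrFun (S.hEsym i hi) y) z
  rw [h1]
  exact Complex.conj_eq_iff_im.2 (S.hEreal i hi y z)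

theorem E_star {i : ℕ} (hi : i ≤ S.D) (y z : X) : star (S.E i y z) = S.E i y z :=
  Complex.conj_eq_iff_im.2 (S.hEreal i hi y z)

theorem E_symm {i : ℕ} (hi : i ≤ S.D) (y z : X) : S.E i y z = S.E i z y :=
  congrFun (congrFun (S.hEsym i hi) z) y

theorem E_dist {i : ℕ} (hi : i ≤ S.D) {y z y' z' : X} (h : S.G.dist y z = S.G.dist y' z') :
    S.E i y z = S.E i y' z' := by
  refine Submodule.span_induction (p := fun B _ => B y z = B y' z') ?_ ?_ ?_ ?_ (S.hEinM i hi)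
  · rintro _ ⟨k, _, rfl⟩
    simp [h]
  · rfl
  · intro B C _ _ hB hC
    simp [hB, hC]
  · intro c B _ hB
    simp [hB]

theorem adj_herm : S.adj.IsHermitian := by
  ext y z
  simp only [adj, Amat, Matrix.conjTranspose_apply, Matrix.of_apply, S.G.dist_comm (u := z)]
  split_ifs <;> simp

theorem Astar_herm : (S.Astar x).IsHermitian := by
  rw [Astar, Matrix.isHermitian_diagonal_iff]
  intro y
  rw [IsSelfAdjoint, star_mul', S.E_star (by have := S.hD3; omega)]
  simp

theorem Estar_herm (k : ℕ) : (S.Estar x k).IsHermitian := by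
  rw [Estar, Matrix.isHermitian_diagonal_iff]
  intro y
  rw [IsSelfAdjoint]
  split_ifs <;> simp

theorem E_adj {i : ℕ} (hi : i ≤ S.D) : S.E i * S.adj = (S.θ i : ℂ) • S.E i := by
  have h : S.adj * S.E i = (S.θ i : ℂ) • S.E i := S.hAE i hi
  have := congrArg Matrix.conjTranspose h
  rw [Matrix.conjTranspose_mul, Matrix.conjTranspose_smul, (S.E_herm hi).eq, S.adj_herm.eq] at this
  simpa using this

theorem card_ne (S : QPolyDRG X) : (Fintype.card X : ℂ) ≠ 0 := by
  have : Nonempty X := S.conn.nonempty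
  exact_mod_cast Fintype.card_ne_zero

theorem E_ind {y z : X} (h : S.E 1 x y = S.E 1 x z) : ∀ i ≤ S.D, S.E i x y = S.E i x z := by
  intro i
  have hD := S.hD3
  induction i using Nat.strong_induction_on with
  | _ i ih =>
    intro hi
    rcases i with _ | _ | i
    · rw [S.hE0]; simp
    · exact h
    · have hk := S.hKrein 1 (by omega) (i + 1) (by omega)
      have e1 := congrFun (congrFun hk x) y
      have e2 := congrFun (congrFun hk x) z
      have e3 : Matrix.hadamard (S.E 1) (S.E (i+1)) x y = Matrix.hadamard (S.E 1) (S.E (i+1)) x z := by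
        rw [Matrix.hadamard_apply, Matrix.hadamard_apply, h, ih (i+1) (by omega) (by omega)]
      rw [e1, e2, Matrix.smul_apply, Matrix.smul_apply, smul_eq_mul, smul_eq_mul] at e3
      have e4 := mul_left_cancel₀ (inv_ne_zero S.card_ne) e3
      rw [Matrix.sum_apply, Matrix.sum_apply, ← sub_eq_zero, ← Finset.sum_sub_distrib,
        Finset.sum_eq_single (i + 1 + 1)] at e4
      · simp only [Matrix.smul_apply, smul_eq_mul] at e4
        rw [← mul_sub] at e4
        rcases mul_eq_zero.1 e4 with e | e
        · exact absurd (by exact_mod_cast e) (S.hq_ne (i+1+1) hi 1 (by omega) (i+1) (by omega) (by omega))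
        · exact sub_eq_zero.1 e
      · intro l hl hne
        have hl' : l ≤ S.D := by simp at hl; omega
        simp only [Matrix.smul_apply, smul_eq_mul]
        rcases lt_or_gt_of_ne hne with hlt | hgt
        · rw [ih l hlt hl', sub_self]
        · rw [S.hq_zero l hl' 1 (by omega) (i+1) (by omega) (by omega)]; simp
      · intro h; simp at h; omega

theorem adj_pow (n : ℕ) : S.adj ^ n = ∑ i ∈ Finset.range (S.D + 1), ((S.θ i : ℂ) ^ n) • S.E i := by
  induction n with
  | zero => simp [S.hEsum]
  | succ n ih =>
    rw [pow_succ, ih, Finset.sum_mul]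
    refine Finset.sum_congr rfl fun i hi => ?_
    rw [Matrix.smul_mul, S.E_adj (by simp at hi; omega), smul_smul, pow_succ]

theorem dist_le_of_E {y z : X} (h : S.E 1 x y = S.E 1 x z) : S.G.dist x z ≤ S.G.dist x y := by
  classical
  have hA : S.adj = S.G.adjMatrix ℂ := by
    ext a b
    simp [adj, Amat, SimpleGraph.adjMatrix_apply, SimpleGraph.dist_eq_one_iff_adj]
  have hp : (S.adj ^ (S.G.dist x y)) x y = (S.adj ^ (S.G.dist x y)) x z := by
    rw [adj_pow, Matrix.sum_apply, Matrix.sum_apply]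
    refine Finset.sum_congr rfl fun i hi => ?_
    rw [Matrix.smul_apply, Matrix.smul_apply, S.E_ind x h i (by simp at hi; omega)]
  rw [hA, SimpleGraph.adjMatrix_pow_apply_eq_card_walk,
    SimpleGraph.adjMatrix_pow_apply_eq_card_walk] at hp
  have hp' := Nat.cast_injective hp
  obtain ⟨p, hp1⟩ := S.conn.exists_walk_length_eq_dist x y
  have hpos : 0 < Fintype.card {p : S.G.Walk x y | p.length = S.G.dist x y} :=
    Fintype.card_pos_iff.2 ⟨⟨p, hp1⟩⟩
  rw [hp'] at hpos
  obtain ⟨⟨w, hw⟩⟩ := Fintype.card_pos_iff.1 hpos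
  have hw : w.length = S.G.dist x y := hw
  rw [← hw]
  exact SimpleGraph.dist_le w

theorem dist_eq_of_E {y z : X} (h : S.E 1 x y = S.E 1 x z) : S.G.dist x y = S.G.dist x z :=
  le_antisymm (S.dist_le_of_E x h.symm) (S.dist_le_of_E x h)

open Classical in
def dualθ (i : ℕ) : ℂ :=
  if h : ∃ y, S.G.dist x y = i then (Fintype.card X : ℂ) * S.E 1 x h.choose else 0

theorem dualθ_eq (y : X) : S.dualθ x (S.G.dist x y) = (Fintype.card X : ℂ) * S.E 1 x y := by
  have h : ∃ z, S.G.dist x z = S.G.dist x y := ⟨y, rfl⟩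
  rw [dualθ, dif_pos h, S.E_dist (by have := S.hD3; omega) h.choose_spec]

theorem Estar_Astar (i : ℕ) : S.Estar x i * S.Astar x = S.dualθ x i • S.Estar x i := by
  rw [Estar, Astar, Matrix.diagonal_mul_diagonal, ← Matrix.diagonal_smul]
  congr 1
  ext y
  simp only [Pi.smul_apply, smul_eq_mul]
  split_ifs with h
  · rw [← h, dualθ_eq]; ring
  · simp

theorem dualθ_inj (k l : ℕ) (h : S.dualθ x k = S.dualθ x l) :
    k = l ∨ S.Estar x l = 0 ∨ S.Estar x k = 0 := by
  have hz : ∀ k, (¬ ∃ y, S.G.dist x y = k) → S.Estar x k = 0 := by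
    intro k hk
    rw [Estar, ← Matrix.diagonal_zero]
    congr 1
    ext y
    rw [if_neg (fun h => hk ⟨y, h⟩)]
  by_cases hk : ∃ y, S.G.dist x y = k
  · by_cases hl : ∃ y, S.G.dist x y = l
    · obtain ⟨y, rfl⟩ := hk
      obtain ⟨z, rfl⟩ := hl
      rw [dualθ_eq, dualθ_eq] at h
      exact Or.inl (S.dist_eq_of_E x (mul_left_cancel₀ S.card_ne h))
    · exact Or.inr (Or.inl (hz l hl))
  · exact Or.inr (Or.inr (hz k hk))

theorem Estar_adj_Estar {k l : ℕ} (h : k + 1 < l ∨ l + 1 < k) :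
    S.Estar x k * S.adj * S.Estar x l = 0 := by
  ext y z
  rw [Estar, Estar, Matrix.mul_diagonal, Matrix.diagonal_mul, adj, Amat]
  simp only [Matrix.of_apply, Matrix.zero_apply]
  split_ifs with h1 h2 h3 <;> try simp
  have t1 := S.conn.dist_triangle (u := x) (v := y) (w := z)
  have t2 := S.conn.dist_triangle (u := x) (v := z) (w := y)
  rw [S.G.dist_comm (u := z)] at t2
  omega

open scoped ComplexOrder in
theorem E_Astar_E {k l : ℕ} (hk : k ≤ S.D) (hl : l ≤ S.D) (h : k + 1 < l ∨ l + 1 < k) :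
    S.E k * S.Astar x * S.E l = 0 := by
  have hD := S.hD3
  have h1D : 1 ≤ S.D := by omega
  have hK : Matrix.hadamard (S.E k) (S.E l) * S.E 1 = 0 := by
    rw [S.hKrein k hk l hl, Matrix.smul_mul, Finset.sum_mul]
    rw [Finset.sum_eq_zero, smul_zero]
    intro m hm
    rw [Matrix.smul_mul, S.hEmul m (by simp at hm; omega) 1 h1D]
    split_ifs with hm1
    · rw [hm1, S.hq_zero 1 h1D k hk l hl (by omega)]; simp
    · simp
  rw [← Matrix.trace_conjTranspose_mul_self_eq_zero_iff]
  rw [Matrix.conjTranspose_mul, Matrix.conjTranspose_mul, (S.E_herm hk).eq, (S.E_herm hl).eq,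
    (S.Astar_herm x).eq]
  have hkk : S.E k * S.E k = S.E k := by rw [S.hEmul k hk k hk, if_pos rfl]
  have hll : S.E l * S.E l = S.E l := by rw [S.hEmul l hl l hl, if_pos rfl]
  have e1 : S.E l * (S.Astar x * S.E k) * (S.E k * S.Astar x * S.E l)
      = S.E l * (S.Astar x * S.E k * S.Astar x * S.E l) := by
    calc _ = S.E l * (S.Astar x * (S.E k * S.E k) * S.Astar x * S.E l) := by
          simp only [Matrix.mul_assoc]
      _ = _ := by rw [hkk]
  rw [e1, Matrix.trace_mul_comm, Matrix.mul_assoc _ (S.E l), hll]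
  have e2 : ∀ w, (S.Astar x * S.E k * S.Astar x * S.E l) w w =
      (Fintype.card X : ℂ) ^ 2 * (S.E 1 x w * (Matrix.hadamard (S.E k) (S.E l) * S.E 1) w x) := by
    intro w
    rw [Matrix.mul_apply, Matrix.mul_apply, Finset.mul_sum, Finset.mul_sum]
    refine Finset.sum_congr rfl fun v _ => ?_
    rw [Astar, Matrix.mul_diagonal, Matrix.diagonal_mul, Matrix.hadamard_apply,
      S.E_symm hl v w, S.E_symm h1D v x]
    ring
  rw [Matrix.trace]
  refine Finset.sum_eq_zero fun w _ => ?_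
  rw [Matrix.diag_apply, e2, hK]
  simp

theorem toE_mul (B C : Matrix X X ℂ) (v : EuclideanSpace ℂ X) :
    Matrix.toEuclideanLin B (Matrix.toEuclideanLin C v) = Matrix.toEuclideanLin (B * C) v := by
  simp [Matrix.toLpLin_apply]

theorem Estar_sum : ∑ k ∈ Finset.range (S.D + 1), S.Estar x k = 1 := by
  ext y z
  rw [Matrix.sum_apply]
  simp only [Estar, Matrix.diagonal_apply, Matrix.one_apply]
  split_ifs with h
  · rw [Finset.sum_ite_eq, if_pos]
    have := S.dist_le x y
    simp; omega
  · simp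

theorem toE_sum (s : Finset ℕ) (B : ℕ → Matrix X X ℂ) (v : EuclideanSpace ℂ X) :
    ∑ k ∈ s, Matrix.toEuclideanLin (B k) v = Matrix.toEuclideanLin (∑ k ∈ s, B k) v := by
  rw [map_sum, LinearMap.sum_apply]

theorem toE_one (v : EuclideanSpace ℂ X) :
    Matrix.toEuclideanLin (1 : Matrix X X ℂ) v = v := by
  simp [Matrix.toLpLin_apply]

def toTD : TDSys (EuclideanSpace ℂ X) where
  D := S.D
  A := Matrix.toEuclideanLin S.adj
  B := Matrix.toEuclideanLin (S.Astar x)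
  P := fun k => Matrix.toEuclideanLin (S.E k)
  Q := fun k => Matrix.toEuclideanLin (S.Estar x k)
  a := fun k => (S.θ k : ℂ)
  b := S.dualθ x
  Asym := Matrix.isSymmetric_toEuclideanLin_iff.2 S.adj_herm
  Bsym := Matrix.isSymmetric_toEuclideanLin_iff.2 (S.Astar_herm x)
  Psym := fun k hk => Matrix.isSymmetric_toEuclideanLin_iff.2 (S.E_herm hk)
  Qsym := fun k _ => Matrix.isSymmetric_toEuclideanLin_iff.2 (S.Estar_herm x k)
  Psum := fun v => by rw [toE_sum, S.hEsum, toE_one]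
  Qsum := fun v => by rw [toE_sum, S.Estar_sum, toE_one]
  Porth := fun k hk l hl hne v => by
    rw [toE_mul, S.hEmul k hk l hl, if_neg hne, map_zero]; rfl
  Qorth := fun k hk l hl hne v => by
    have : S.Estar x k * S.Estar x l = 0 := by
      rw [Estar, Estar, Matrix.diagonal_mul_diagonal, ← Matrix.diagonal_zero]
      congr 1
      ext y
      by_cases h : S.G.dist x y = k
      · rw [if_neg (c := S.G.dist x y = l) (by omega), mul_zero]
      · rw [if_neg h, zero_mul]
    rw [toE_mul, this, map_zero]; rfl
  PA := fun k hk v => by rw [toE_mul, S.E_adj hk, map_smul]; rfl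
  QB := fun k hk v => by rw [toE_mul, S.Estar_Astar, map_smul]; rfl
  ainj := fun k hk l hl h => Or.inl (S.θ_inj k hk l hl (by exact_mod_cast h))
  binj := fun k hk l hl h => by
    rcases S.dualθ_inj x k l h with h | h | h
    · exact Or.inl h
    · exact Or.inr (Or.inl (by rw [h, map_zero]))
    · exact Or.inr (Or.inr (by rw [h, map_zero]))
  QAQ := fun k hk l hl h v => by
    rw [toE_mul, toE_mul, S.Estar_adj_Estar x h, map_zero]; rfl
  PBP := fun k hk l hl h v => by
    rw [toE_mul, toE_mul, S.E_Astar_E x hk hl h, map_zero]; rfl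

theorem EV_nat {k : ℕ} (hk : k ≤ S.D) : S.EV (k : ℤ) = LinearMap.range ((S.toTD x).P k) := by
  rw [EV, if_pos ⟨by omega, by exact_mod_cast hk⟩]; rfl

theorem EstarV_nat {k : ℕ} (hk : k ≤ S.D) :
    S.EstarV x (k : ℤ) = LinearMap.range ((S.toTD x).swap.P k) := by
  rw [EstarV, if_pos ⟨by omega, by exact_mod_cast hk⟩]; rfl

theorem mem_supEV (s : Finset ℕ) (hs : ∀ k ∈ s, k ≤ S.D) (v : EuclideanSpace ℂ X) :
    v ∈ (⨆ k ∈ s, S.EV (k : ℤ)) ↔ ∀ k ≤ S.D, k ∉ s → (S.toTD x).P k v = 0 := by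
  rw [iSup_congr fun k => iSup_congr fun hk => S.EV_nat x (hs k hk)]
  exact (S.toTD x).iSup_range s hs v

theorem mem_supEstarV (s : Finset ℕ) (hs : ∀ k ∈ s, k ≤ S.D) (v : EuclideanSpace ℂ X) :
    v ∈ (⨆ k ∈ s, S.EstarV x (k : ℤ)) ↔ ∀ k ≤ S.D, k ∉ s → (S.toTD x).Q k v = 0 := by
  rw [iSup_congr fun k => iSup_congr fun hk => S.EstarV_nat x (hs k hk)]
  exact (S.toTD x).swap.iSup_range s hs v

theorem Vdd {i j : ℕ} (hi : i ≤ S.D) (hj : j ≤ S.D) :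
    S.Vsplit x false false i j = (S.toTD x).F (i + 1) ⊓ (S.toTD x).G (j + 1) := by
  ext v
  rw [Vsplit, if_pos ⟨by omega, by omega⟩]
  simp only [Bool.false_eq_true, if_false, Int.toNat_natCast, Submodule.mem_inf]
  rw [S.mem_supEstarV x _ (by intro k hk; simp at hk; omega),
    S.mem_supEV x _ (by intro k hk; simp at hk; omega), TDSys.mem_F, TDSys.mem_G]
  simp only [Finset.mem_range, not_lt]
  rfl

theorem rev_iff {D r : ℕ} (hr : r ≤ D) (p : ℕ → Prop) :
    (∀ k ≤ D, k ∉ Finset.Icc (D - r) D → p k) ↔ ∀ k ≤ D, r + 1 ≤ k → p (D - k) := by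
  constructor
  · intro h k hk hrk
    exact h (D - k) (by omega) (by simp; omega)
  · intro h k hk hks
    have := h (D - k) (by omega) (by simp at hks; omega)
    rwa [show D - (D - k) = k by omega] at this

theorem Vuu {i j : ℕ} (hi : i ≤ S.D) (hj : j ≤ S.D) :
    S.Vsplit x true true i j = (S.toTD x).rev.F (i + 1) ⊓ (S.toTD x).rev.G (j + 1) := by
  ext v
  rw [Vsplit, if_pos ⟨by omega, by omega⟩]
  simp only [if_true, Int.toNat_natCast, Submodule.mem_inf]
  rw [S.mem_supEstarV x _ (by intro k hk; simp at hk; omega),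
    S.mem_supEV x _ (by intro k hk; simp at hk; omega), TDSys.mem_F, TDSys.mem_G,
    rev_iff hi (fun k => (S.toTD x).Q k v = 0), rev_iff hj (fun k => (S.toTD x).P k v = 0)]
  rfl

theorem F_le_pred (T : TDSys (EuclideanSpace ℂ X)) (μ : Bool) {D : ℕ}
    (hV : ∀ i j : ℕ, i ≤ D → j ≤ D → S.Vsplit x μ μ i j = T.F (i + 1) ⊓ T.G (j + 1))
    {i j : ℕ} (hi : i ≤ D) (hj : j ≤ D) {u : EuclideanSpace ℂ X}
    (hu : u ∈ S.tildeV x μ μ i j) :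
    u ∈ T.F (i + 1) ⊓ T.G (j + 1) ∧ (∀ w ∈ T.F i ⊓ T.G (j + 1), inner ℂ u w = 0) ∧
      ∀ w ∈ T.F (i + 1) ⊓ T.G j, inner ℂ u w = 0 := by
  obtain ⟨h1, h2⟩ := hu
  refine ⟨hV i j hi hj ▸ h1, ?_, ?_⟩
  · intro w hw
    rcases i with _ | i
    · rw [T.F_zero hw.1, inner_zero_right]
    · rw [← hV i j (by omega) hj] at hw
      refine (Submodule.mem_orthogonal' _ _).1 h2 w (Submodule.mem_sup_left ?_)
      simpa using hw
  · intro w hw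
    rcases j with _ | j
    · rw [T.G_zero hw.2, inner_zero_right]
    · rw [← hV i j hi (by omega)] at hw
      refine (Submodule.mem_orthogonal' _ _).1 h2 w (Submodule.mem_sup_right ?_)
      simpa using hw

end QPolyDRG

open QPolyDRG in
/-- `Ṽ^{↓↓}_{i,j}` and `Ṽ^{↑↑}_{r,s}` are orthogonal with respect to the standard
Hermitian form unless `i + r = D` and `j + s = D`. -/
theorem drg_tildeV_duality_dd_uu {X : Type*} [Fintype X] [DecidableEq X]
    (S : QPolyDRG X) (x : X) :
    ∀ i : ℕ, i ≤ S.D → ∀ j : ℕ, j ≤ S.D → ∀ r : ℕ, r ≤ S.D → ∀ s : ℕ, s ≤ S.D →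
      ¬(i + r = S.D ∧ j + s = S.D) →
      ∀ u ∈ S.tildeV x false false i j, ∀ v ∈ S.tildeV x true true r s,
        ⟪u, v⟫ = 0 := by
  intro i hi j hj r hr s hs hne u hu v hv
  obtain ⟨a1, a2, a3⟩ := S.F_le_pred x (S.toTD x) false (fun i j hi hj => S.Vdd x hi hj) hi hj hu
  obtain ⟨b1, b2, b3⟩ :=
    S.F_le_pred x (S.toTD x).rev true (fun i j hi hj => S.Vuu x hi hj) hr hs hv
  exact (S.toTD x).main hi hj hne a1 a2 a3 b1 b2 b3

end
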